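/- arXiv:1409.6936 — 4 statements merged into one kernel-verified Lean document; each statement's English description precedes it below -/
import Mathlib

section
/- Let H be a Hopf group-coalgebra over a group G and let α be an automorphism of H with components α_p: H_p → H_p. Define the twisted multiplication m̄_p = α_p ∘ m_p on each H_p and the twisted comultiplication Δ̄_{p,q} = Δ_{p,q} ∘ α_{pq}^{-1}: H_{pq} → H_p ⊗ H_q. Then (H, α) with these twisted structures (same units 1_p, same counit ε, same antipode S_p) is a group-cograded monoidal Hom-Hopf algebra over G: each (H_p, m̄_p, 1_p, α_p) is a monoidal Hom-algebra, the maps Δ̄_{p,q} and ε satisfy the group-cograded monoidal Hom-coalgebra axioms, each Δ̄_{p,q} and ε are multiplicative and unital with respect to m̄, and the antipode axioms m̄_p ∘ (S_{p^{-1}} ⊗ id) ∘ Δ̄_{p^{-1},p} = ε(·)1_p = m̄_p ∘ (id ⊗ S_{p^{-1}}) ∘ Δ̄_{p,p^{-1}} hold on H_e. -/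
open TensorProduct

noncomputable section

section Cast

variable (k : Type*) [Field k] {G : Type*} [Group G] {H : G → Type*}
  [∀ p, AddCommGroup (H p)] [∀ p, Module k (H p)]

/-- Transport of components along an equality of group elements. -/
def cst {a b : G} (h : a = b) : H a →ₗ[k] H b := by subst h; exact LinearMap.id

/-- Transport of components along an equality of group elements, as a linear equivalence. -/
def cstE {a b : G} (h : a = b) : H a ≃ₗ[k] H b := by subst h; exact LinearEquiv.refl k (H a)

end Cast

/-- A (classical) Hopf group-coalgebra over a group `G`. -/
structure HopfGC (k : Type*) [Field k] (G : Type*) [Group G] (H : G → Type*)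
    [∀ p, AddCommGroup (H p)] [∀ p, Module k (H p)] where
  mul : ∀ p : G, H p →ₗ[k] H p →ₗ[k] H p
  one : ∀ p : G, H p
  comul : ∀ p q : G, H (p * q) →ₗ[k] H p ⊗[k] H q
  counit : H (1 : G) →ₗ[k] k
  antipode : ∀ p : G, H p →ₗ[k] H p⁻¹
  mul_assoc' : ∀ (p : G) (a b c : H p), mul p (mul p a b) c = mul p a (mul p b c)
  one_mul' : ∀ (p : G) (a : H p), mul p (one p) a = a
  mul_one' : ∀ (p : G) (a : H p), mul p a (one p) = a
  coassoc : ∀ p q r : G,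
    (TensorProduct.assoc k (H p) (H q) (H r)).toLinearMap.comp
      ((TensorProduct.map (comul p q) LinearMap.id).comp (comul (p * q) r))
    = (TensorProduct.map LinearMap.id (comul q r)).comp
        ((comul p (q * r)).comp (cst k (mul_assoc p q r)))
  counit_comul' : ∀ (p : G) (c : H p),
    (TensorProduct.lid k (H p))
      ((TensorProduct.map counit LinearMap.id) (comul 1 p (cst k (one_mul p).symm c))) = c
  comul_counit' : ∀ (p : G) (c : H p),
    (TensorProduct.rid k (H p))
      ((TensorProduct.map LinearMap.id counit) (comul p 1 (cst k (mul_one p).symm c))) = c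
  comul_mul : ∀ (p q : G) (a b : H (p * q)),
    comul p q (mul (p * q) a b)
      = TensorProduct.map₂ (mul p) (mul q) (comul p q a) (comul p q b)
  comul_one : ∀ p q : G, comul p q (one (p * q)) = (one p) ⊗ₜ[k] (one q)
  counit_mul : ∀ a b : H (1 : G), counit (mul 1 a b) = counit a * counit b
  counit_one : counit (one 1) = 1
  antipode_left : ∀ (p : G) (h : H (1 : G)),
    TensorProduct.lift (mul p)
      ((TensorProduct.map ((cst k (inv_inv p)).comp (antipode p⁻¹)) LinearMap.id)
        (comul p⁻¹ p (cst k (show (1 : G) = p⁻¹ * p by group) h)))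
    = counit h • one p
  antipode_right : ∀ (p : G) (h : H (1 : G)),
    TensorProduct.lift (mul p)
      ((TensorProduct.map LinearMap.id ((cst k (inv_inv p)).comp (antipode p⁻¹)))
        (comul p p⁻¹ (cst k (show (1 : G) = p * p⁻¹ by group) h)))
    = counit h • one p

/-- An automorphism of a Hopf group-coalgebra. -/
structure HopfGCAut {k : Type*} [Field k] {G : Type*} [Group G] {H : G → Type*}
    [∀ p, AddCommGroup (H p)] [∀ p, Module k (H p)] (D : HopfGC k G H) where
  α : ∀ p : G, H p ≃ₗ[k] H p
  map_mul : ∀ (p : G) (a b : H p), α p (D.mul p a b) = D.mul p (α p a) (α p b)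
  map_one : ∀ p : G, α p (D.one p) = D.one p
  map_comul : ∀ (p q : G) (c : H (p * q)),
    TensorProduct.map (α p).toLinearMap (α q).toLinearMap (D.comul p q c)
      = D.comul p q (α (p * q) c)
  map_counit : ∀ c : H (1 : G), D.counit (α 1 c) = D.counit c
  map_antipode : ∀ (p : G) (h : H p), D.antipode p (α p h) = α p⁻¹ (D.antipode p h)

/-- The axioms of a group-cograded monoidal Hom-Hopf algebra, for given structure data. -/
structure IsGCHH (k : Type*) [Field k] {G : Type*} [Group G] {H : G → Type*}
    [∀ p, AddCommGroup (H p)] [∀ p, Module k (H p)]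
    (mul : ∀ p : G, H p →ₗ[k] H p →ₗ[k] H p) (one : ∀ p : G, H p)
    (comul : ∀ p q : G, H (p * q) →ₗ[k] H p ⊗[k] H q) (counit : H (1 : G) →ₗ[k] k)
    (antipode : ∀ p : G, H p →ₗ[k] H p⁻¹) (α : ∀ p : G, H p ≃ₗ[k] H p) : Prop where
  hom_assoc : ∀ (p : G) (a b c : H p), mul p (α p a) (mul p b c) = mul p (mul p a b) (α p c)
  one_mul' : ∀ (p : G) (a : H p), mul p (one p) a = α p a
  mul_one' : ∀ (p : G) (a : H p), mul p a (one p) = α p a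
  α_mul : ∀ (p : G) (a b : H p), α p (mul p a b) = mul p (α p a) (α p b)
  α_one : ∀ p : G, α p (one p) = one p
  hcoassoc : ∀ p q r : G,
    (TensorProduct.map (α p).symm.toLinearMap (comul q r)).comp
      ((comul p (q * r)).comp (cst k (mul_assoc p q r)))
    = (TensorProduct.assoc k (H p) (H q) (H r)).toLinearMap.comp
        ((TensorProduct.map (comul p q) (α r).symm.toLinearMap).comp (comul (p * q) r))
  counit_comul' : ∀ (p : G) (c : H p),
    (TensorProduct.lid k (H p))
      ((TensorProduct.map counit LinearMap.id) (comul 1 p (cst k (one_mul p).symm c)))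
    = (α p).symm c
  comul_counit' : ∀ (p : G) (c : H p),
    (TensorProduct.rid k (H p))
      ((TensorProduct.map LinearMap.id counit) (comul p 1 (cst k (mul_one p).symm c)))
    = (α p).symm c
  comul_αinv : ∀ (p q : G) (c : H (p * q)),
    comul p q ((α (p * q)).symm c)
      = TensorProduct.map (α p).symm.toLinearMap (α q).symm.toLinearMap (comul p q c)
  counit_αinv : ∀ c : H (1 : G), counit ((α 1).symm c) = counit c
  comul_mul : ∀ (p q : G) (a b : H (p * q)),
    comul p q (mul (p * q) a b)
      = TensorProduct.map₂ (mul p) (mul q) (comul p q a) (comul p q b)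
  comul_one : ∀ p q : G, comul p q (one (p * q)) = (one p) ⊗ₜ[k] (one q)
  counit_mul : ∀ a b : H (1 : G), counit (mul 1 a b) = counit a * counit b
  counit_one : counit (one 1) = 1
  antipode_α : ∀ (p : G) (h : H p), antipode p (α p h) = (α p⁻¹) (antipode p h)
  antipode_left : ∀ (p : G) (h : H (1 : G)),
    TensorProduct.lift (mul p)
      ((TensorProduct.map ((cst k (inv_inv p)).comp (antipode p⁻¹)) LinearMap.id)
        (comul p⁻¹ p (cst k (show (1 : G) = p⁻¹ * p by group) h)))
    = counit h • one p
  antipode_right : ∀ (p : G) (h : H (1 : G)),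
    TensorProduct.lift (mul p)
      ((TensorProduct.map LinearMap.id ((cst k (inv_inv p)).comp (antipode p⁻¹)))
        (comul p p⁻¹ (cst k (show (1 : G) = p * p⁻¹ by group) h)))
    = counit h • one p

/-- The axioms of a crossing on a group-cograded (monoidal Hom-)Hopf algebra. -/
structure IsCrossing (k : Type*) [Field k] {G : Type*} [Group G] {H : G → Type*}
    [∀ p, AddCommGroup (H p)] [∀ p, Module k (H p)]
    (mul : ∀ p : G, H p →ₗ[k] H p →ₗ[k] H p) (one : ∀ p : G, H p)
    (comul : ∀ p q : G, H (p * q) →ₗ[k] H p ⊗[k] H q) (counit : H (1 : G) →ₗ[k] k)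
    (α : ∀ p : G, H p ≃ₗ[k] H p)
    (π : ∀ q p : G, H p ≃ₗ[k] H (q * p * q⁻¹)) : Prop where
  π_mul : ∀ (q p : G) (a b : H p),
    π q p (mul p a b) = mul (q * p * q⁻¹) (π q p a) (π q p b)
  π_one : ∀ q p : G, π q p (one p) = one (q * p * q⁻¹)
  π_α : ∀ (q p : G) (a : H p), π q p (α p a) = α (q * p * q⁻¹) (π q p a)
  π_comul : ∀ (q a b : G) (c : H (a * b)),
    TensorProduct.map (π q a).toLinearMap (π q b).toLinearMap (comul a b c)
      = comul (q * a * q⁻¹) (q * b * q⁻¹)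
          (cst k (show q * (a * b) * q⁻¹ = (q * a * q⁻¹) * (q * b * q⁻¹) by group) (π q (a * b) c))
  π_counit : ∀ (q : G) (c : H (1 : G)),
    counit (cst k (show q * (1 : G) * q⁻¹ = 1 by group) (π q 1 c)) = counit c
  π_mult : ∀ (a b p : G) (c : H p),
    cst k (show (a * b) * p * (a * b)⁻¹ = a * (b * p * b⁻¹) * a⁻¹ by group) (π (a * b) p c)
      = π a (b * p * b⁻¹) (π b p c)

/-- A (classical) Hopf `T`-coalgebra: a Hopf group-coalgebra with a crossing. -/
structure HopfTC (k : Type*) [Field k] (G : Type*) [Group G] (H : G → Type*)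
    [∀ p, AddCommGroup (H p)] [∀ p, Module k (H p)] extends HopfGC k G H where
  π : ∀ q p : G, H p ≃ₗ[k] H (q * p * q⁻¹)
  π_mul : ∀ (q p : G) (a b : H p),
    π q p (mul p a b) = mul (q * p * q⁻¹) (π q p a) (π q p b)
  π_one : ∀ q p : G, π q p (one p) = one (q * p * q⁻¹)
  π_comul : ∀ (q a b : G) (c : H (a * b)),
    TensorProduct.map (π q a).toLinearMap (π q b).toLinearMap (comul a b c)
      = comul (q * a * q⁻¹) (q * b * q⁻¹)
          (cst k (show q * (a * b) * q⁻¹ = (q * a * q⁻¹) * (q * b * q⁻¹) by group) (π q (a * b) c))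
  π_counit : ∀ (q : G) (c : H (1 : G)),
    counit (cst k (show q * (1 : G) * q⁻¹ = 1 by group) (π q 1 c)) = counit c
  π_antipode : ∀ (q p : G) (h : H p),
    antipode (q * p * q⁻¹) (π q p h)
      = cst k (show q * p⁻¹ * q⁻¹ = (q * p * q⁻¹)⁻¹ by group) (π q p⁻¹ (antipode p h))
  π_mult : ∀ (a b p : G) (c : H p),
    cst k (show (a * b) * p * (a * b)⁻¹ = a * (b * p * b⁻¹) * a⁻¹ by group) (π (a * b) p c)
      = π a (b * p * b⁻¹) (π b p c)

/-- A group-cograded monoidal Hom-Hopf algebra (bundled data). -/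
structure GCHH (k : Type*) [Field k] (G : Type*) [Group G] (H : G → Type*)
    [∀ p, AddCommGroup (H p)] [∀ p, Module k (H p)] where
  mul : ∀ p : G, H p →ₗ[k] H p →ₗ[k] H p
  one : ∀ p : G, H p
  comul : ∀ p q : G, H (p * q) →ₗ[k] H p ⊗[k] H q
  counit : H (1 : G) →ₗ[k] k
  antipode : ∀ p : G, H p →ₗ[k] H p⁻¹
  α : ∀ p : G, H p ≃ₗ[k] H p
  ax : IsGCHH k mul one comul counit antipode α

/-- A monoidal Hom-Hopf `T`-coalgebra with bijective antipode (bundled data). -/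
structure HomTC (k : Type*) [Field k] (G : Type*) [Group G] (H : G → Type*)
    [∀ p, AddCommGroup (H p)] [∀ p, Module k (H p)] where
  mul : ∀ p : G, H p →ₗ[k] H p →ₗ[k] H p
  one : ∀ p : G, H p
  comul : ∀ p q : G, H (p * q) →ₗ[k] H p ⊗[k] H q
  counit : H (1 : G) →ₗ[k] k
  antipode : ∀ p : G, H p ≃ₗ[k] H p⁻¹
  α : ∀ p : G, H p ≃ₗ[k] H p
  π : ∀ q p : G, H p ≃ₗ[k] H (q * p * q⁻¹)
  ax : IsGCHH k mul one comul counit (fun p => (antipode p).toLinearMap) α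
  cax : IsCrossing k mul one comul counit α π

section YD

variable {k : Type*} [Field k] {G : Type*} [Group G] {H : G → Type*}
  [∀ p, AddCommGroup (H p)] [∀ p, Module k (H p)]

variable (k)

/-- The Yetter-Drinfeld compatibility condition (3) of Definition 4.1. -/
def YDcompat (T : HomTC k G H) (p : G) {M : Type*} [AddCommGroup M] [Module k M]
    (μ : M ≃ₗ[k] M) (act : H p →ₗ[k] M →ₗ[k] M)
    (ρ : ∀ r : G, M →ₗ[k] M ⊗[k] H r) : Prop :=
  ∀ r : G,
    (TensorProduct.map (TensorProduct.lift act) (TensorProduct.lift (T.mul r))).comp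
      ((TensorProduct.tensorTensorTensorComm k (H p) (H r) M (H r)).toLinearMap.comp
        (TensorProduct.map (T.comul p r) (ρ r)))
    =
    (TensorProduct.map μ.toLinearMap (TensorProduct.lift (T.mul r))).comp
      ((TensorProduct.assoc k M (H r) (H r)).toLinearMap.comp
        (((TensorProduct.comm k (H r) (M ⊗[k] H r)).toLinearMap).comp
          ((TensorProduct.map
              ((cst k (show p⁻¹ * (p * r * p⁻¹) * p⁻¹⁻¹ = r by group)).comp
                (T.π p⁻¹ (p * r * p⁻¹)).toLinearMap)
              ((ρ r).comp (TensorProduct.lift act))).comp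
            ((TensorProduct.assoc k (H (p * r * p⁻¹)) (H p) M).toLinearMap.comp
              (TensorProduct.map
                ((T.comul (p * r * p⁻¹) p).comp
                  (cst k (show p * r = (p * r * p⁻¹) * p by group)))
                μ.symm.toLinearMap)))))

/-- The axioms of a (left-right) `p`-Yetter-Drinfeld module over a monoidal Hom-Hopf
`T`-coalgebra. -/
structure IsYD (T : HomTC k G H) (p : G) {M : Type*} [AddCommGroup M] [Module k M]
    (μ : M ≃ₗ[k] M) (act : H p →ₗ[k] M →ₗ[k] M)
    (ρ : ∀ r : G, M →ₗ[k] M ⊗[k] H r) : Prop where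
  act_act : ∀ (a b : H p) (m : M), act (T.α p a) (act b m) = act (T.mul p a b) (μ m)
  act_one : ∀ m : M, act (T.one p) m = μ m
  μ_act : ∀ (a : H p) (m : M), μ (act a m) = act (T.α p a) (μ m)
  ρ_coassoc : ∀ a b : G,
    (TensorProduct.map μ.symm.toLinearMap (T.comul a b)).comp (ρ (a * b))
    = (TensorProduct.assoc k M (H a) (H b)).toLinearMap.comp
        ((TensorProduct.map (ρ a) (T.α b).symm.toLinearMap).comp (ρ b))
  ρ_counit : ∀ m : M,
    (TensorProduct.rid k M) ((TensorProduct.map LinearMap.id T.counit) (ρ 1 m)) = μ.symm m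
  ρ_μ : ∀ r : G,
    (ρ r).comp μ.toLinearMap
      = (TensorProduct.map μ.toLinearMap (T.α r).toLinearMap).comp (ρ r)
  compat : YDcompat k T p μ act ρ

/-- The action of `H (a*b)` on a tensor product of an `H a`-module and an `H b`-module. -/
def tAct (T : HomTC k G H) (a b : G) {M N : Type*} [AddCommGroup M] [Module k M]
    [AddCommGroup N] [Module k N]
    (actM : H a →ₗ[k] M →ₗ[k] M) (actN : H b →ₗ[k] N →ₗ[k] N) :
    H (a * b) →ₗ[k] (M ⊗[k] N) →ₗ[k] (M ⊗[k] N) :=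
  (TensorProduct.map₂ actM actN).comp (T.comul a b)

/-- The coaction on the tensor product `M ⊗ N`, where `N` has degree `b`:
`ρ r (m ⊗ n) = m₍₀₎ ⊗ n₍₀₎ ⊗ n₍₁,r₎ ⬝ π_{b⁻¹}(m₍₁,brb⁻¹₎)`. -/
def tCoact (T : HomTC k G H) (b : G) {M N : Type*} [AddCommGroup M] [Module k M]
    [AddCommGroup N] [Module k N]
    (ρM : ∀ r : G, M →ₗ[k] M ⊗[k] H r) (ρN : ∀ r : G, N →ₗ[k] N ⊗[k] H r) (r : G) :
    (M ⊗[k] N) →ₗ[k] (M ⊗[k] N) ⊗[k] H r :=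
  (TensorProduct.map LinearMap.id
      (TensorProduct.lift (((T.mul r).flip).comp
        ((cst k (show b⁻¹ * (b * r * b⁻¹) * b⁻¹⁻¹ = r by group)).comp
          (T.π b⁻¹ (b * r * b⁻¹)).toLinearMap)))).comp
    ((TensorProduct.tensorTensorTensorComm k M (H (b * r * b⁻¹)) N (H r)).toLinearMap.comp
      (TensorProduct.map (ρM (b * r * b⁻¹)) (ρN r)))

/-- The conjugate action on `ᵠM`: `h ⇀ m = π_{s⁻¹}(h) ⬝ m`. -/
def cAct (T : HomTC k G H) (s p : G) {M : Type*} [AddCommGroup M] [Module k M]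
    (act : H p →ₗ[k] M →ₗ[k] M) : H (s * p * s⁻¹) →ₗ[k] M →ₗ[k] M :=
  act.comp ((cst k (show s⁻¹ * (s * p * s⁻¹) * s⁻¹⁻¹ = p by group)).comp
    (T.π s⁻¹ (s * p * s⁻¹)).toLinearMap)

/-- The conjugate coaction on `ˢM`: `ρ r m = m₍₀₎ ⊗ π_s (m₍₁,s⁻¹rs₎)`. -/
def cCoact (T : HomTC k G H) (s : G) {M : Type*} [AddCommGroup M] [Module k M]
    (ρ : ∀ r : G, M →ₗ[k] M ⊗[k] H r) (r : G) : M →ₗ[k] M ⊗[k] H r :=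
  (TensorProduct.map LinearMap.id
      ((cst k (show s * (s⁻¹ * r * s) * s⁻¹ = r by group)).comp
        (T.π s (s⁻¹ * r * s)).toLinearMap)).comp
    (ρ (s⁻¹ * r * s))

/-- The Hom-associator `(A ⊗ B) ⊗ C ≃ A ⊗ (B ⊗ C)`, `(a ⊗ b) ⊗ c ↦ φA a ⊗ (b ⊗ φC⁻¹ c)`. -/
def homAssoc {A B C : Type*} [AddCommGroup A] [Module k A] [AddCommGroup B] [Module k B]
    [AddCommGroup C] [Module k C] (φA : A ≃ₗ[k] A) (φC : C ≃ₗ[k] C) :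
    (A ⊗[k] B) ⊗[k] C ≃ₗ[k] A ⊗[k] (B ⊗[k] C) :=
  (TensorProduct.assoc k A B C).trans
    (TensorProduct.congr φA (TensorProduct.congr (LinearEquiv.refl k B) φC.symm))

/-- The braiding `c_{M,W} : M ⊗ W → ᴹW ⊗ M`,
`m ⊗ w ↦ (S_{w⁻¹}(m₍₁,w⁻¹₎) ⬝ φW⁻¹ w) ⊗ μ m₍₀₎`, where `W` has degree `w`. -/
def braid (T : HomTC k G H) (w : G) {M W : Type*} [AddCommGroup M] [Module k M]
    [AddCommGroup W] [Module k W] (μ : M ≃ₗ[k] M) (ρM : ∀ r : G, M →ₗ[k] M ⊗[k] H r)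
    (actW : H w →ₗ[k] W →ₗ[k] W) (φW : W ≃ₗ[k] W) : (M ⊗[k] W) →ₗ[k] (W ⊗[k] M) :=
  (TensorProduct.comm k M W).toLinearMap.comp
    ((TensorProduct.map μ.toLinearMap
        (TensorProduct.lift (actW.comp
          ((cst k (inv_inv w)).comp (T.antipode w⁻¹).toLinearMap)))).comp
      ((TensorProduct.assoc k M (H w⁻¹) W).toLinearMap.comp
        (TensorProduct.map (ρM w⁻¹) φW.symm.toLinearMap)))

end YD

/-- The axioms of a monoidal Hom-Hopf algebra on a single space. -/
structure IsMonHomHopf (k : Type*) [Field k] (A : Type*) [AddCommGroup A] [Module k A]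
    (mul : A →ₗ[k] A →ₗ[k] A) (one : A) (comul : A →ₗ[k] A ⊗[k] A) (counit : A →ₗ[k] k)
    (S : A →ₗ[k] A) (α : A ≃ₗ[k] A) : Prop where
  hom_assoc : ∀ a b c : A, mul (α a) (mul b c) = mul (mul a b) (α c)
  one_mul' : ∀ a : A, mul one a = α a
  mul_one' : ∀ a : A, mul a one = α a
  α_mul : ∀ a b : A, α (mul a b) = mul (α a) (α b)
  α_one : α one = one
  hcoassoc :
    (TensorProduct.map α.symm.toLinearMap comul).comp comul
    = (TensorProduct.assoc k A A A).toLinearMap.comp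
        ((TensorProduct.map comul α.symm.toLinearMap).comp comul)
  counit_comul' : ∀ a : A,
    (TensorProduct.lid k A) ((TensorProduct.map counit LinearMap.id) (comul a)) = α.symm a
  comul_counit' : ∀ a : A,
    (TensorProduct.rid k A) ((TensorProduct.map LinearMap.id counit) (comul a)) = α.symm a
  comul_αinv : ∀ a : A,
    comul (α.symm a) = TensorProduct.map α.symm.toLinearMap α.symm.toLinearMap (comul a)
  counit_αinv : ∀ a : A, counit (α.symm a) = counit a
  comul_mul : ∀ a b : A, comul (mul a b) = TensorProduct.map₂ mul mul (comul a) (comul b)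
  comul_one : comul one = one ⊗ₜ[k] one
  counit_mul : ∀ a b : A, counit (mul a b) = counit a * counit b
  counit_one : counit one = 1
  antipode_α : ∀ a : A, S (α a) = α (S a)
  antipode_left : ∀ a : A,
    TensorProduct.lift mul ((TensorProduct.map S LinearMap.id) (comul a)) = counit a • one
  antipode_right : ∀ a : A,
    TensorProduct.lift mul ((TensorProduct.map LinearMap.id S) (comul a)) = counit a • one

theorem cst_map_symm {k : Type*} [Field k] {G : Type*} [Group G] {H : G → Type*}
    [∀ p, AddCommGroup (H p)] [∀ p, Module k (H p)] (α : ∀ p : G, H p ≃ₗ[k] H p)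
    {a b : G} (h : a = b) (x : H a) :
    (α b).symm (cst k h x) = cst k h ((α a).symm x) := by
  subst h
  rfl

theorem TensorProduct.lift_compr₂_apply {k M N P Q : Type*} [CommSemiring k]
    [AddCommMonoid M] [AddCommMonoid N] [AddCommMonoid P] [AddCommMonoid Q]
    [Module k M] [Module k N] [Module k P] [Module k Q]
    (f : M →ₗ[k] N →ₗ[k] P) (g : P →ₗ[k] Q) (x : M ⊗[k] N) :
    TensorProduct.lift (f.compr₂ g) x = g (TensorProduct.lift f x) := by
  rw [TensorProduct.lift_compr₂]
  rfl

theorem TensorProduct.map₂_compr₂_apply {k M N P Q M' N' P' Q' : Type*} [CommSemiring k]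
    [AddCommMonoid M] [AddCommMonoid N] [AddCommMonoid P] [AddCommMonoid Q]
    [AddCommMonoid M'] [AddCommMonoid N'] [AddCommMonoid P'] [AddCommMonoid Q']
    [Module k M] [Module k N] [Module k P] [Module k Q]
    [Module k M'] [Module k N'] [Module k P'] [Module k Q']
    (f : M →ₗ[k] N →ₗ[k] P) (g : P →ₗ[k] Q) (f' : M' →ₗ[k] N' →ₗ[k] P') (g' : P' →ₗ[k] Q')
    (x : M ⊗[k] M') (y : N ⊗[k] N') :
    TensorProduct.map₂ (f.compr₂ g) (f'.compr₂ g') x y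
      = TensorProduct.map g g' (TensorProduct.map₂ f f' x y) := by
  induction x with
  | zero => simp
  | add x x' hx hx' => simp only [map_add, LinearMap.add_apply, hx, hx']
  | tmul a b =>
    induction y with
    | zero => simp
    | add y y' hy hy' => simp only [map_add, hy, hy']
    | tmul c d => simp

namespace HopfGCAut

variable {k : Type*} [Field k] {G : Type*} [Group G] {H : G → Type*}
  [∀ p, AddCommGroup (H p)] [∀ p, Module k (H p)] {D : HopfGC k G H} (A : HopfGCAut D)

theorem map_mul_symm (p : G) (a b : H p) :
    (A.α p).symm (D.mul p a b) = D.mul p ((A.α p).symm a) ((A.α p).symm b) := by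
  rw [LinearEquiv.symm_apply_eq, A.map_mul, LinearEquiv.apply_symm_apply,
    LinearEquiv.apply_symm_apply]

theorem map_one_symm (p : G) : (A.α p).symm (D.one p) = D.one p := by
  rw [LinearEquiv.symm_apply_eq, A.map_one]

theorem map_counit_symm (c : H (1 : G)) : D.counit ((A.α 1).symm c) = D.counit c := by
  rw [← A.map_counit, LinearEquiv.apply_symm_apply]

theorem map_comul_symm (p q : G) (c : H (p * q)) :
    TensorProduct.map (A.α p).symm.toLinearMap (A.α q).symm.toLinearMap (D.comul p q c)
      = D.comul p q ((A.α (p * q)).symm c) := by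
  obtain ⟨c, rfl⟩ := (A.α (p * q)).surjective c
  rw [← A.map_comul, ← LinearMap.comp_apply, ← TensorProduct.map_comp]
  simp

end HopfGCAut

/-- Twisting a Hopf group-coalgebra by an automorphism yields a group-cograded
monoidal Hom-Hopf algebra. -/
theorem statement0 {k : Type*} [Field k] {G : Type*} [Group G] {H : G → Type*}
    [∀ p, AddCommGroup (H p)] [∀ p, Module k (H p)]
    (D : HopfGC k G H) (A : HopfGCAut D) :
    IsGCHH k
      (fun p => (D.mul p).compr₂ (A.α p).toLinearMap)
      D.one
      (fun p q => (D.comul p q).comp (A.α (p * q)).symm.toLinearMap)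
      D.counit D.antipode A.α := by
  refine
    { hom_assoc := fun p a b c => ?_
      one_mul' := fun p a => ?_
      mul_one' := fun p a => ?_
      α_mul := fun p a b => ?_
      α_one := A.map_one
      hcoassoc := fun p q r => ?_
      counit_comul' := fun p c => ?_
      comul_counit' := fun p c => ?_
      comul_αinv := fun p q c => ?_
      counit_αinv := A.map_counit_symm
      comul_mul := fun p q a b => ?_
      comul_one := fun p q => ?_
      counit_mul := fun a b => ?_
      counit_one := D.counit_one
      antipode_α := A.map_antipode
      antipode_left := fun p h => ?_
      antipode_right := fun p h => ?_ }
  · simp [A.map_mul, D.mul_assoc']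
  · simp [D.one_mul']
  · simp [D.mul_one']
  · simp [A.map_mul]
  · ext c
    have hl : TensorProduct.map (A.α p).symm.toLinearMap
          ((D.comul q r).comp (A.α (q * r)).symm.toLinearMap)
        = (TensorProduct.map LinearMap.id (D.comul q r)).comp
          (TensorProduct.map (A.α p).symm.toLinearMap (A.α (q * r)).symm.toLinearMap) := by
      rw [← TensorProduct.map_comp, LinearMap.id_comp]
    have hr : TensorProduct.map ((D.comul p q).comp (A.α (p * q)).symm.toLinearMap)
          (A.α r).symm.toLinearMap
        = (TensorProduct.map (D.comul p q) LinearMap.id).comp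
          (TensorProduct.map (A.α (p * q)).symm.toLinearMap (A.α r).symm.toLinearMap) := by
      rw [← TensorProduct.map_comp, LinearMap.id_comp]
    have h := LinearMap.congr_fun (D.coassoc p q r)
      ((A.α (p * q * r)).symm ((A.α (p * q * r)).symm c))
    simp only [LinearMap.comp_apply, LinearEquiv.coe_coe] at h
    simp only [hl, hr, LinearMap.comp_apply, LinearEquiv.coe_coe, A.map_comul_symm,
      cst_map_symm, h]
  · simp only [LinearMap.comp_apply, LinearEquiv.coe_coe, cst_map_symm, D.counit_comul']
  · simp only [LinearMap.comp_apply, LinearEquiv.coe_coe, cst_map_symm, D.comul_counit']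
  · simp only [LinearMap.comp_apply, LinearEquiv.coe_coe, A.map_comul_symm]
  · simp only [LinearMap.comp_apply, LinearEquiv.coe_coe, LinearMap.compr₂_apply,
      TensorProduct.map₂_compr₂_apply, ← D.comul_mul, A.map_comul, ← A.map_mul_symm,
      LinearEquiv.apply_symm_apply, LinearEquiv.symm_apply_apply]
  · simp only [LinearMap.comp_apply, LinearEquiv.coe_coe, A.map_one_symm, D.comul_one]
  · simp only [LinearMap.compr₂_apply, LinearEquiv.coe_coe, A.map_counit, D.counit_mul]
  · simp only [LinearMap.comp_apply, LinearEquiv.coe_coe, TensorProduct.lift_compr₂_apply,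
      cst_map_symm, D.antipode_left, map_smul, A.map_one, A.map_counit_symm]
  · simp only [LinearMap.comp_apply, LinearEquiv.coe_coe, TensorProduct.lift_compr₂_apply,
      cst_map_symm, D.antipode_right, map_smul, A.map_one, A.map_counit_symm]
end
end

section
/- Let H be a Hopf group-coalgebra over a group G and let α be an automorphism of H with components α_p: H_p → H_p. Define Δ̄_{p,q} = Δ_{p,q} ∘ α_{pq}^{-1}: H_{pq} → H_p ⊗ H_q. Then for all p, q, r ∈ G the Hom-coassociativity condition holds: (α_p^{-1} ⊗ Δ̄_{q,r}) ∘ Δ̄_{p,qr} = (Δ̄_{p,q} ⊗ α_r^{-1}) ∘ Δ̄_{pq,r} as maps H_{pqr} → H_p ⊗ H_q ⊗ H_r. -/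
open TensorProduct

noncomputable section

/-- Transport along an equality of degrees commutes with any degreewise family of
linear endomorphisms. -/
theorem comp_cst {k : Type*} [Field k] {G : Type*} [Group G] {H : G → Type*}
    [∀ p, AddCommGroup (H p)] [∀ p, Module k (H p)] (f : ∀ p : G, H p →ₗ[k] H p)
    {a b : G} (h : a = b) : (f b).comp (cst k h) = (cst k h).comp (f a) := by
  subst h
  rfl

/-- The inverse of an automorphism is compatible with the comultiplication. -/
theorem HopfGCAut.map_symm_comp_comul {k : Type*} [Field k] {G : Type*} [Group G]
    {H : G → Type*} [∀ p, AddCommGroup (H p)] [∀ p, Module k (H p)]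
    {D : HopfGC k G H} (A : HopfGCAut D) (p q : G) :
    (TensorProduct.map (A.α p).symm.toLinearMap (A.α q).symm.toLinearMap).comp (D.comul p q)
      = (D.comul p q).comp (A.α (p * q)).symm.toLinearMap := by
  ext c
  obtain ⟨d, rfl⟩ := (A.α (p * q)).surjective c
  simp [← A.map_comul, TensorProduct.map_map]

/-- Hom-coassociativity of the twisted comultiplication
`Δ̄_{p,q} = Δ_{p,q} ∘ α_{pq}⁻¹`. -/
theorem statement1 {k : Type*} [Field k] {G : Type*} [Group G] {H : G → Type*}
    [∀ p, AddCommGroup (H p)] [∀ p, Module k (H p)]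
    (D : HopfGC k G H) (A : HopfGCAut D) (p q r : G) :
    (TensorProduct.map (A.α p).symm.toLinearMap
        ((D.comul q r).comp (A.α (q * r)).symm.toLinearMap)).comp
      (((D.comul p (q * r)).comp (A.α (p * (q * r))).symm.toLinearMap).comp
        (cst k (mul_assoc p q r)))
    = (TensorProduct.assoc k (H p) (H q) (H r)).toLinearMap.comp
        ((TensorProduct.map ((D.comul p q).comp (A.α (p * q)).symm.toLinearMap)
            (A.α r).symm.toLinearMap).comp
          ((D.comul (p * q) r).comp (A.α (p * q * r)).symm.toLinearMap)) := by
  rw [← LinearMap.id_comp (A.α p).symm.toLinearMap, TensorProduct.map_comp,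
    ← LinearMap.id_comp (A.α r).symm.toLinearMap, TensorProduct.map_comp]
  have hl := LinearMap.congr_fun (A.map_symm_comp_comul p (q * r))
  have hr := LinearMap.congr_fun (A.map_symm_comp_comul (p * q) r)
  have h_cst := LinearMap.congr_fun
    (comp_cst (fun g => (A.α g).symm.toLinearMap) (mul_assoc p q r))
  have h_coassoc := LinearMap.congr_fun (D.coassoc p q r)
  ext x
  simp only [LinearMap.comp_apply] at hl hr h_cst h_coassoc ⊢
  rw [hl, hr, h_coassoc, h_cst, h_cst]
end
end

section
/- Let (H, α) be a monoidal Hom-Hopf T-coalgebra over G with bijective antipode, p ∈ G, and let (M, μ) be a k-vector space with a linear automorphism μ that is a left H_p-Hom-module and a right H-Hom-comodule (axioms (4.1)–(4.3)). Then the Yetter–Drinfeld compatibility condition: for all r ∈ G, h ∈ H_{pr}, m ∈ M, h_{(1,p)}·m_{(0)} ⊗ h_{(2,r)}m_{(1,r)} = μ((h_{(2,p)}·μ^{-1}(m))_{(0)}) ⊗ (h_{(2,p)}·μ^{-1}(m))_{(1,r)} π_{p^{-1}}(h_{(1,prp^{-1})}), holds if and only if for all r ∈ G, h ∈ H_p,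 m ∈ M: (h·m)_{(0)} ⊗ (h·m)_{(1,r)} = α_p(h_{(12,p)})·m_{(0)} ⊗ α_r^{-1}(h_{(2,r)}m_{(1,r)}) S_r^{-1}(π_{p^{-1}}(α_{pr^{-1}p^{-1}}(h_{(11,pr^{-1}p^{-1})}))), where S_r^{-1}: H_{r^{-1}} → H_r is the inverse of the antipode S_r and h_{(11,pr^{-1}p^{-1})} ⊗ h_{(12,p)} ⊗ h_{(2,r)} denotes the iterated comultiplication of h ∈ H_p = H_{(pr^{-1}p^{-1})(p)(r)}. -/
open TensorProduct

noncomputable section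

variable {k : Type*} [Field k] {G : Type*} [Group G] {H : G → Type*}
  [∀ p, AddCommGroup (H p)] [∀ p, Module k (H p)]

variable (k) in
/-- The right-hand side of the reformulated compatibility condition (4.7):
`(h⬝m)₍₀₎ ⊗ (h⬝m)₍₁,r₎ = α_p(h₍₁₂,p₎)⬝m₍₀₎ ⊗
  α_r⁻¹(h₍₂,r₎ m₍₁,r₎) S_r⁻¹(π_{p⁻¹}(α_{pr⁻¹p⁻¹}(h₍₁₁,pr⁻¹p⁻¹₎)))`. -/
def rhs47 (T : HomTC k G H) (p : G) {M : Type*} [AddCommGroup M] [Module k M]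
    (μ : M ≃ₗ[k] M) (act : H p →ₗ[k] M →ₗ[k] M) (ρ : ∀ r : G, M →ₗ[k] M ⊗[k] H r)
    (r : G) : (H p ⊗[k] M) →ₗ[k] M ⊗[k] H r :=
  (TensorProduct.map LinearMap.id (TensorProduct.lift ((T.mul r).flip))).comp
    ((TensorProduct.assoc k M (H r) (H r)).toLinearMap.comp
      ((TensorProduct.map (TensorProduct.comm k (H r) M).toLinearMap LinearMap.id).comp
        ((TensorProduct.map
            ((TensorProduct.map LinearMap.id (TensorProduct.lift act)).comp
              (TensorProduct.assoc k (H r) (H p) M).toLinearMap)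
            ((T.α r).symm.toLinearMap.comp (TensorProduct.lift (T.mul r)))).comp
          ((TensorProduct.tensorTensorTensorComm k (H r ⊗[k] H p) (H r) M (H r)).toLinearMap.comp
            (TensorProduct.map
              ((TensorProduct.map
                  (TensorProduct.map
                    ((T.antipode r).symm.toLinearMap.comp
                      ((cst k (show p⁻¹ * (p * r⁻¹ * p⁻¹) * p⁻¹⁻¹ = r⁻¹ by group)).comp
                        ((T.π p⁻¹ (p * r⁻¹ * p⁻¹)).toLinearMap.comp
                          (T.α (p * r⁻¹ * p⁻¹)).toLinearMap)))
                    (T.α p).toLinearMap)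
                  LinearMap.id).comp
                ((TensorProduct.map
                    ((T.comul (p * r⁻¹ * p⁻¹) p).comp
                      (cst k (show p * r⁻¹ = (p * r⁻¹ * p⁻¹) * p by group)))
                    LinearMap.id).comp
                  ((T.comul (p * r⁻¹) r).comp
                    (cst k (show p = (p * r⁻¹) * r by group)))))
              (ρ r))))))

namespace HomTC

variable (T : HomTC k G H)

/-- The associative multiplication `α⁻¹ (x y)` underlying the Hom-multiplication. -/
def dmul (r : G) : H r →ₗ[k] H r →ₗ[k] H r :=
  (T.mul r).compr₂ (T.α r).symm.toLinearMap

/-- The coassociative comultiplication `(α ⊗ α) ∘ Δ` underlying the Hom-comultiplication. -/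
def dcomul {a b c : G} (h : a * b = c) : H c →ₗ[k] H a ⊗[k] H b :=
  (TensorProduct.map (T.α a).toLinearMap (T.α b).toLinearMap).comp
    ((T.comul a b).comp (cst k h.symm))

theorem dmul_apply {r : G} (x y : H r) : T.dmul r x y = (T.α r).symm (T.mul r x y) := rfl

theorem α_symm_mul {r : G} (x y : H r) :
    (T.α r).symm (T.mul r x y) = T.mul r ((T.α r).symm x) ((T.α r).symm y) := by
  rw [LinearEquiv.symm_apply_eq, T.ax.α_mul]; simp

theorem dmul_assoc {r : G} (x y z : H r) :
    T.dmul r (T.dmul r x y) z = T.dmul r x (T.dmul r y z) := by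
  have h := T.ax.hom_assoc r ((T.α r).symm ((T.α r).symm x)) ((T.α r).symm ((T.α r).symm y))
    ((T.α r).symm ((T.α r).symm z))
  simp only [LinearEquiv.apply_symm_apply] at h
  simp only [dmul_apply, α_symm_mul, h]

theorem dmul_one {r : G} (x : H r) : T.dmul r x (T.one r) = x := by
  simp [dmul_apply, T.ax.mul_one']

theorem one_dmul {r : G} (x : H r) : T.dmul r (T.one r) x = x := by
  simp [dmul_apply, T.ax.one_mul']

theorem comul_α {a b : G} (x : H (a * b)) :
    T.comul a b (T.α (a * b) x)
      = TensorProduct.map (T.α a).toLinearMap (T.α b).toLinearMap (T.comul a b x) := by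
  have h := T.ax.comul_αinv a b (T.α (a * b) x)
  rw [LinearEquiv.symm_apply_apply] at h
  rw [h, ← LinearMap.comp_apply, ← TensorProduct.map_comp]
  simp

theorem counit_α (x : H (1 : G)) : T.counit (T.α 1 x) = T.counit x := by
  have h := T.ax.counit_αinv (T.α 1 x)
  rwa [LinearEquiv.symm_apply_apply, eq_comm] at h

theorem comul_cst_α {a b c : G} (h : c = a * b) (x : H c) :
    T.comul a b (cst k h (T.α c x))
      = TensorProduct.map (T.α a).toLinearMap (T.α b).toLinearMap (T.comul a b (cst k h x)) := by
  subst h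
  exact T.comul_α x

theorem comul_coassoc {a b c ab bc d : G} (hab : a * b = ab) (hbc : b * c = bc)
    (h : ab * c = d) (h' : a * bc = d) (x : H d) :
    TensorProduct.map (T.α a).symm.toLinearMap ((T.comul b c).comp (cst k hbc.symm))
        (T.comul a bc (cst k h'.symm x))
      = TensorProduct.assoc k (H a) (H b) (H c)
          (TensorProduct.map ((T.comul a b).comp (cst k hab.symm)) (T.α c).symm.toLinearMap
            (T.comul ab c (cst k h.symm x))) := by
  subst hab hbc h
  exact LinearMap.congr_fun (T.ax.hcoassoc a b c) x

theorem dcomul_coassoc {a b c ab bc d : G} (hab : a * b = ab) (hbc : b * c = bc)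
    (h : ab * c = d) (h' : a * bc = d) (x : H d) :
    TensorProduct.map LinearMap.id (T.dcomul hbc) (T.dcomul h' x)
      = TensorProduct.assoc k (H a) (H b) (H c)
          (TensorProduct.map (T.dcomul hab) LinearMap.id (T.dcomul h x)) := by
  have key := congrArg (TensorProduct.map ((T.α a).toLinearMap.comp (T.α a).toLinearMap)
    (TensorProduct.map ((T.α b).toLinearMap.comp (T.α b).toLinearMap)
      ((T.α c).toLinearMap.comp (T.α c).toLinearMap)))
    (T.comul_coassoc hab hbc h h' x)
  refine Eq.trans ?_ (key.trans ?_)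
  · simp only [dcomul, LinearMap.comp_apply]
    generalize T.comul a bc (cst k h'.symm x) = t
    induction t with
    | zero => simp
    | add s t hs ht => simp only [map_add, hs, ht]
    | tmul u v =>
      simp only [TensorProduct.map_tmul, LinearMap.comp_apply, LinearEquiv.coe_coe,
        LinearMap.id_apply, LinearEquiv.apply_symm_apply, comul_cst_α, TensorProduct.map_comp]
  · simp only [dcomul, LinearMap.comp_apply]
    generalize T.comul ab c (cst k h.symm x) = t
    induction t with
    | zero => simp
    | add s t hs ht => simp only [map_add, hs, ht]
    | tmul u v =>
      simp only [TensorProduct.map_tmul, LinearMap.comp_apply, LinearEquiv.coe_coe,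
        LinearMap.id_apply, comul_cst_α]
      generalize T.comul a b (cst k hab.symm u) = s
      induction s with
      | zero => simp
      | add s t hs ht => simp only [map_add, TensorProduct.add_tmul, hs, ht]
      | tmul y z => simp

theorem dcomul_dmul {a b c : G} (h : a * b = c) (x y : H c) :
    T.dcomul h (T.dmul c x y)
      = TensorProduct.map₂ (T.dmul a) (T.dmul b) (T.dcomul h x) (T.dcomul h y) := by
  subst h
  change TensorProduct.map _ _ (T.comul a b ((T.α (a * b)).symm (T.mul (a * b) x y)))
    = TensorProduct.map₂ _ _ (TensorProduct.map _ _ (T.comul a b x))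
      (TensorProduct.map _ _ (T.comul a b y))
  rw [T.ax.comul_αinv, T.ax.comul_mul]
  generalize T.comul a b x = s
  generalize T.comul a b y = t
  induction s with
  | zero => simp
  | add s s' hs hs' => simp only [map_add, LinearMap.add_apply, hs, hs']
  | tmul u v =>
    induction t with
    | zero => simp
    | add t t' ht ht' => simp only [map_add, ht, ht']
    | tmul y z => simp [dmul_apply, ← T.ax.α_mul]

theorem dcomul_one {a b c : G} (h : a * b = c) :
    T.dcomul h (T.one c) = T.one a ⊗ₜ T.one b := by
  subst h
  change TensorProduct.map _ _ (T.comul a b (T.one (a * b))) = _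
  simp [T.ax.comul_one, T.ax.α_one]

section Convolution

variable {U V W X Y Z : Type*} [AddCommGroup U] [Module k U] [AddCommGroup V] [Module k V]
  [AddCommGroup W] [Module k W] [AddCommGroup X] [Module k X] [AddCommGroup Y] [Module k Y]
  [AddCommGroup Z] [Module k Z]

/-- The convolution `x ↦ β (f x₁) (g x₂)` along a bilinear map `β`, bilinear in `f` and `g`. -/
def conv (β : U →ₗ[k] V →ₗ[k] W) {a b c : G} (h : a * b = c) :
    (H a →ₗ[k] U) →ₗ[k] (H b →ₗ[k] V) →ₗ[k] (H c →ₗ[k] W) :=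
  LinearMap.mk₂ k (fun f g => (TensorProduct.lift (β.compl₁₂ f g)).comp (T.dcomul h))
    (fun f f' g => by
      rw [← LinearMap.add_comp]; congr 1; ext; simp)
    (fun r f g => by
      rw [← LinearMap.smul_comp]; congr 1; ext; simp)
    (fun f g g' => by
      rw [← LinearMap.add_comp]; congr 1; ext; simp)
    (fun r f g => by
      rw [← LinearMap.smul_comp]; congr 1; ext; simp)

theorem conv_apply (β : U →ₗ[k] V →ₗ[k] W) {a b c : G} (h : a * b = c)
    (f : H a →ₗ[k] U) (g : H b →ₗ[k] V) (x : H c) :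
    T.conv β h f g x = TensorProduct.lift (β.compl₁₂ f g) (T.dcomul h x) := rfl

theorem conv_assoc {β₁ : X →ₗ[k] W →ₗ[k] Z} {β₂ : U →ₗ[k] V →ₗ[k] X}
    {β₃ : U →ₗ[k] Y →ₗ[k] Z} {β₄ : V →ₗ[k] W →ₗ[k] Y}
    (hβ : ∀ u v w, β₁ (β₂ u v) w = β₃ u (β₄ v w))
    {a b c ab bc d : G} (hab : a * b = ab) (hbc : b * c = bc)
    (h : ab * c = d) (h' : a * bc = d)
    (f : H a →ₗ[k] U) (g : H b →ₗ[k] V) (w : H c →ₗ[k] W) :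
    T.conv β₁ h (T.conv β₂ hab f g) w = T.conv β₃ h' f (T.conv β₄ hbc g w) := by
  ext x
  let τ : H a ⊗[k] (H b ⊗[k] H c) →ₗ[k] Z :=
    TensorProduct.lift (β₃.compl₁₂ f (TensorProduct.lift (β₄.compl₁₂ g w)))
  have key := congrArg τ (T.dcomul_coassoc hab hbc h h' x)
  refine Eq.trans ?_ (key.symm.trans ?_)
  · rw [conv_apply]
    generalize T.dcomul h x = t
    induction t with
    | zero => simp
    | add s t hs ht => simp only [map_add, hs, ht]
    | tmul u v =>
      simp only [TensorProduct.map_tmul, TensorProduct.lift.tmul, LinearMap.compl₁₂_apply,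
        conv_apply, LinearMap.id_apply]
      generalize T.dcomul hab u = s
      induction s with
      | zero => simp
      | add s t hs ht => simp only [map_add, TensorProduct.add_tmul, LinearMap.add_apply, hs, ht]
      | tmul y z => simp [τ, hβ]
  · rw [conv_apply]
    generalize T.dcomul h' x = t
    induction t with
    | zero => simp
    | add s t hs ht => simp only [map_add, hs, ht]
    | tmul u v => simp [τ, conv_apply]

theorem conv_counit_left {β : U →ₗ[k] V →ₗ[k] V} {u : U} (hβ : ∀ v, β u v = v) {a : G}
    (h : 1 * a = a) (g : H a →ₗ[k] V) :
    T.conv β h (T.counit.smulRight u) g = g := by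
  ext x
  have key := congrArg g (congrArg (T.α a) (T.ax.counit_comul' a x))
  rw [LinearEquiv.apply_symm_apply] at key
  refine Eq.trans ?_ key
  simp only [conv_apply, dcomul, LinearMap.comp_apply]
  generalize T.comul 1 a _ = t
  induction t with
  | zero => simp
  | add s t hs ht => simp only [map_add, hs, ht]
  | tmul y z => simp [hβ, counit_α]

theorem conv_counit_right {β : U →ₗ[k] V →ₗ[k] U} {v : V} (hβ : ∀ u, β u v = u) {a : G}
    (h : a * 1 = a) (f : H a →ₗ[k] U) :
    T.conv β h f (T.counit.smulRight v) = f := by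
  ext x
  have key := congrArg f (congrArg (T.α a) (T.ax.comul_counit' a x))
  rw [LinearEquiv.apply_symm_apply] at key
  refine Eq.trans ?_ key
  simp only [conv_apply, dcomul, LinearMap.comp_apply]
  generalize T.comul a 1 _ = t
  induction t with
  | zero => simp
  | add s t hs ht => simp only [map_add, hs, ht]
  | tmul y z => simp [hβ, counit_α]

end Convolution

/-- The antipode with its target transported along an equality. -/
def dS {a b : G} (h : a⁻¹ = b) : H a →ₗ[k] H b := (cst k h).comp (T.antipode a).toLinearMap

theorem dS_α {a b : G} (h : a⁻¹ = b) (x : H a) : T.dS h (T.α a x) = T.α b (T.dS h x) := by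
  subst h
  exact T.ax.antipode_α a x

theorem conv_dS_id {a b : G} (h : a * b = 1) (h' : a⁻¹ = b) :
    T.conv (T.dmul b) h (T.dS h') LinearMap.id = T.counit.smulRight (T.one b) := by
  obtain rfl : a = b⁻¹ := eq_inv_of_mul_eq_one_left h
  ext x
  refine Eq.trans ?_ (T.ax.antipode_left b x)
  simp only [conv_apply, dcomul, LinearMap.comp_apply]
  generalize T.comul b⁻¹ b _ = t
  induction t with
  | zero => simp
  | add s t hs ht => simp only [map_add, hs, ht]
  | tmul y z =>
    simp [dmul_apply, dS_α, ← T.ax.α_mul]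
    rfl

theorem conv_id_dS {a b : G} (h : a * b = 1) (h' : b⁻¹ = a) :
    T.conv (T.dmul a) h LinearMap.id (T.dS h') = T.counit.smulRight (T.one a) := by
  obtain rfl : b = a⁻¹ := eq_inv_of_mul_eq_one_right h
  ext x
  refine Eq.trans ?_ (T.ax.antipode_right a x)
  simp only [conv_apply, dcomul, LinearMap.comp_apply]
  generalize T.comul a a⁻¹ _ = t
  induction t with
  | zero => simp
  | add s t hs ht => simp only [map_add, hs, ht]
  | tmul y z =>
    simp [dmul_apply, dS_α, ← T.ax.α_mul]
    rfl

theorem antipode_one (p : G) : T.antipode p (T.one p) = T.one p⁻¹ := by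
  have h := LinearMap.congr_fun (T.conv_dS_id (mul_inv_cancel p) rfl) (T.one 1)
  have h' : T.dS rfl (T.one p) = T.one p⁻¹ := by
    simpa [conv_apply, dcomul_one, dmul_one, T.ax.counit_one] using h
  exact h'

theorem conv_conv_dmul {a b c r : G} (h : a * b = c) (f : H a →ₗ[k] H r) (g : H b →ₗ[k] H r)
    (x y : H c) :
    T.conv (T.conv (T.dmul r) h) h ((T.dmul a).compr₂ f) ((T.dmul b).compr₂ g) x y
      = T.conv (T.dmul r) h f g (T.dmul c x y) := by
  rw [conv_apply, conv_apply, dcomul_dmul]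
  generalize T.dcomul h x = s
  induction s with
  | zero => simp
  | add s s' hs hs' => simp only [map_add, LinearMap.add_apply, hs, hs']
  | tmul u v =>
    simp only [TensorProduct.lift.tmul, LinearMap.compl₁₂_apply, conv_apply]
    generalize T.dcomul h y = t
    induction t with
    | zero => simp
    | add t t' ht ht' => simp only [map_add, ht, ht']
    | tmul y z => simp

theorem conv_conv_dmul_dS {a b : G} (h : a * b = 1) (h' : b⁻¹ = a) (x y : H (1 : G)) :
    T.conv (T.conv (T.dmul a) h) h (T.dmul a)
        ((T.dmul a).flip.compl₁₂ (T.dS h') (T.dS h')) x y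
      = T.counit y • T.conv (T.dmul a) h LinearMap.id (T.dS h') x := by
  rw [conv_apply, conv_apply]
  generalize T.dcomul h x = s
  induction s with
  | zero => simp
  | add s s' hs hs' => simp only [map_add, LinearMap.add_apply, hs, hs', smul_add]
  | tmul u v =>
    have key : T.conv (T.dmul a) h (T.dmul a u)
        (((T.dmul a).flip.compl₁₂ (T.dS h') (T.dS h')) v) y
        = T.dmul a u
          (T.dmul a (T.conv (T.dmul a) h LinearMap.id (T.dS h') y) (T.dS h' v)) := by
      rw [conv_apply, conv_apply]
      generalize T.dcomul h y = t
      induction t with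
      | zero => simp
      | add t t' ht ht' => simp only [map_add, LinearMap.add_apply, ht, ht']
      | tmul y z => simp [dmul_assoc]
    simp only [TensorProduct.lift.tmul, LinearMap.compl₁₂_apply] at key ⊢
    rw [key, conv_id_dS]
    simp [one_dmul]

theorem counit_dmul (x y : H (1 : G)) :
    T.counit (T.dmul 1 x y) = T.counit x * T.counit y := by
  rw [dmul_apply, T.ax.counit_αinv, T.ax.counit_mul]

theorem antipode_dmul (p : G) (x y : H p) :
    T.antipode p (T.dmul p x y) = T.dmul p⁻¹ (T.antipode p y) (T.antipode p x) := by
  let n := T.dmul p⁻¹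
  let F : H p →ₗ[k] H p →ₗ[k] H p⁻¹ := (T.dmul p).compr₂ (T.dS rfl)
  let N : H p⁻¹ →ₗ[k] H p⁻¹ →ₗ[k] H p⁻¹ := n
  let K : H p →ₗ[k] H p →ₗ[k] H p⁻¹ := n.flip.compl₁₂ (T.dS rfl) (T.dS rfl)
  let E : H (1 : G) →ₗ[k] H (1 : G) →ₗ[k] H p⁻¹ :=
    T.counit.smulRight (T.counit.smulRight (T.one p⁻¹))
  have hn : ∀ u v w, n (n u v) w = n u (n v w) := fun u v w => T.dmul_assoc u v w
  have hFN : T.conv (T.conv n (mul_inv_cancel p)) (mul_inv_cancel p) F N = E := by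
    ext x y
    have h := T.conv_conv_dmul (mul_inv_cancel p) (T.dS rfl) LinearMap.id x y
    rw [conv_dS_id] at h
    refine h.trans ?_
    simp [E, counit_dmul, mul_smul]
  have hNK : T.conv (T.conv n (inv_mul_cancel p)) (inv_mul_cancel p) N K = E := by
    ext x y
    refine (T.conv_conv_dmul_dS (inv_mul_cancel p) rfl x y).trans ?_
    rw [conv_id_dS]
    exact smul_comm _ _ _
  have hassoc := T.conv_assoc (T.conv_assoc hn (mul_inv_cancel p) (inv_mul_cancel p)
    (one_mul p) (mul_one p)) (mul_inv_cancel p) (inv_mul_cancel p)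
    (one_mul p) (mul_one p) F N K
  rw [hFN, hNK,
    T.conv_counit_left (fun v => T.conv_counit_left (fun w => T.one_dmul w) _ v),
    T.conv_counit_right (fun v => T.conv_counit_right (fun w => T.dmul_one w) _ v)] at hassoc
  exact (LinearMap.congr_fun₂ hassoc x y).symm

theorem conv_flip_antipode_symm_id (r : G) :
    T.conv (T.dmul r).flip (inv_mul_cancel r) (T.antipode r).symm.toLinearMap LinearMap.id
      = T.counit.smulRight (T.one r) := by
  ext x
  apply (T.antipode r).injective
  have h := LinearMap.congr_fun (T.conv_id_dS (inv_mul_cancel r) rfl) x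
  refine Eq.trans ?_ (h.trans ?_)
  · rw [conv_apply, conv_apply]
    generalize T.dcomul _ x = t
    induction t with
    | zero => simp
    | add t t' ht ht' => simp only [map_add, ht, ht']
    | tmul y z =>
      simp [antipode_dmul]
      rfl
  · simp [antipode_one]

theorem conv_flip_id_antipode_symm (r : G) :
    T.conv (T.dmul r).flip (mul_inv_cancel r) LinearMap.id (T.antipode r).symm.toLinearMap
      = T.counit.smulRight (T.one r) := by
  ext x
  apply (T.antipode r).injective
  have h := LinearMap.congr_fun (T.conv_dS_id (mul_inv_cancel r) rfl) x
  refine Eq.trans ?_ (h.trans ?_)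
  · rw [conv_apply, conv_apply]
    generalize T.dcomul _ x = t
    induction t with
    | zero => simp
    | add t t' ht ht' => simp only [map_add, ht, ht']
    | tmul y z =>
      simp [antipode_dmul]
      rfl
  · simp [antipode_one]

/-- The crossing with its target transported along an equality. -/
def dπ (q : G) {a b : G} (h : q * a * q⁻¹ = b) : H a →ₗ[k] H b :=
  (cst k h).comp (T.π q a).toLinearMap

theorem dπ_α (q : G) {a b : G} (h : q * a * q⁻¹ = b) (x : H a) :
    T.dπ q h (T.α a x) = T.α b (T.dπ q h x) := by
  subst h
  exact T.cax.π_α q a x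

theorem dcomul_dπ (q : G) {a b c a' b' c' : G} (ha : q * a * q⁻¹ = a') (hb : q * b * q⁻¹ = b')
    (hc : q * c * q⁻¹ = c') (h : a * b = c) (h' : a' * b' = c') (x : H c) :
    T.dcomul h' (T.dπ q hc x) = TensorProduct.map (T.dπ q ha) (T.dπ q hb) (T.dcomul h x) := by
  subst h ha hb hc
  have key := T.cax.π_comul q a b x
  change TensorProduct.map _ _ (T.comul _ _ (cst k _ (T.π q (a * b) x)))
    = TensorProduct.map _ _ (TensorProduct.map _ _ (T.comul a b x))
  rw [← key]
  generalize T.comul a b x = t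
  induction t with
  | zero => simp
  | add t t' ht ht' => simp only [map_add, ht, ht']
  | tmul y z =>
    simp only [TensorProduct.map_tmul, LinearEquiv.coe_coe, dπ_α]
    rfl

theorem conv_comp_dπ {U V W : Type*} [AddCommGroup U] [Module k U] [AddCommGroup V] [Module k V]
    [AddCommGroup W] [Module k W] (β : U →ₗ[k] V →ₗ[k] W)
    (q : G) {a b a' b' : G} (ha : q * a * q⁻¹ = a') (hb : q * b * q⁻¹ = b')
    (h : a * b = 1) (h' : a' * b' = 1) (f : H a' →ₗ[k] U) (g : H b' →ₗ[k] V) {w : W}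
    (hfg : T.conv β h' f g = T.counit.smulRight w) :
    T.conv β h (f.comp (T.dπ q ha)) (g.comp (T.dπ q hb)) = T.counit.smulRight w := by
  ext x
  have h1 : q * 1 * q⁻¹ = 1 := by group
  have h2 : T.counit (T.dπ q h1 x) = T.counit x := T.cax.π_counit q x
  have key := LinearMap.congr_fun hfg (T.dπ q h1 x)
  rw [LinearMap.smulRight_apply, h2] at key
  refine Eq.trans ?_ key
  rw [conv_apply, conv_apply, T.dcomul_dπ q ha hb h1 h h']
  generalize T.dcomul h x = t
  induction t with
  | zero => simp
  | add t t' ht ht' => simp only [map_add, ht, ht']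
  | tmul y z => simp

theorem antipode_symm_α (r : G) (x : H r⁻¹) :
    (T.antipode r).symm (T.α r⁻¹ x) = T.α r ((T.antipode r).symm x) := by
  rw [LinearEquiv.symm_apply_eq]
  have h := T.ax.antipode_α r ((T.antipode r).symm x)
  simp only [LinearEquiv.coe_coe, LinearEquiv.apply_symm_apply] at h
  exact h.symm

section Module

variable {M : Type*} [AddCommGroup M] [Module k M]

/-- `H r` acting on maps `φ : M → M ⊗ H r` by `(y, φ) ↦ (id ⊗ (· * y)) ∘ φ`. -/
def rmulAct (r : G) : H r →ₗ[k] (M →ₗ[k] M ⊗[k] H r) →ₗ[k] (M →ₗ[k] M ⊗[k] H r) :=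
  (LinearMap.llcomp k M (M ⊗[k] H r) (M ⊗[k] H r)).comp
    ((LinearMap.lTensorHom M).comp (T.dmul r).flip)

theorem rmulAct_apply {r : G} (y : H r) (φ : M →ₗ[k] M ⊗[k] H r) (m : M) :
    T.rmulAct r y φ m = ((T.dmul r).flip y).lTensor M (φ m) := rfl

theorem rmulAct_rmulAct {r : G} (y z : H r) (φ : M →ₗ[k] M ⊗[k] H r) :
    T.rmulAct r ((T.dmul r).flip y z) φ = T.rmulAct r y (T.rmulAct r z φ) := by
  ext m
  simp only [rmulAct_apply]
  generalize φ m = t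
  induction t with
  | zero => simp
  | add t t' ht ht' => simp only [map_add, ht, ht']
  | tmul y z => simp [dmul_assoc]

theorem rmulAct_one {r : G} (φ : M →ₗ[k] M ⊗[k] H r) :
    T.rmulAct r (T.one r) φ = φ := by
  ext m
  simp only [rmulAct_apply]
  generalize φ m = t
  induction t with
  | zero => simp
  | add t t' ht ht' => simp only [map_add, ht, ht']
  | tmul y z => simp [dmul_one]

/-- The map `h ↦ m ↦ h₍₁,p₎ ⬝ m₍₀₎ ⊗ h₍₂,r₎ m₍₁,r₎`. -/
def diagAct (p r : G) (act : H p →ₗ[k] M →ₗ[k] M) (ρ : M →ₗ[k] M ⊗[k] H r) :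
    H (p * r) →ₗ[k] M →ₗ[k] M ⊗[k] H r :=
  TensorProduct.curry
    ((TensorProduct.map (TensorProduct.lift act) (TensorProduct.lift (T.mul r))).comp
      ((TensorProduct.tensorTensorTensorComm k (H p) (H r) M (H r)).toLinearMap.comp
        (TensorProduct.map (T.comul p r) ρ)))

/-- Convolution with mutually inverse `P` and `Q` exchanges the two sides of an equation. -/
theorem eq_conv_iff {U V : Type*} [AddCommGroup U] [Module k U] [AddCommGroup V] [Module k V]
    {β : U →ₗ[k] U →ₗ[k] U} {σ : U →ₗ[k] V →ₗ[k] V} {e : U}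
    (hσ : ∀ y z v, σ (β y z) v = σ y (σ z v)) (he : ∀ v, σ e v = v)
    {a b c d : G} (hab : a * b = 1) (hba : b * a = 1) (hc : a * c = d) (hd : b * d = c)
    {P : H a →ₗ[k] U} {Q : H b →ₗ[k] U}
    (hPQ : T.conv β hab P Q = T.counit.smulRight e)
    (hQP : T.conv β hba Q P = T.counit.smulRight e)
    (R : H c →ₗ[k] V) (L : H d →ₗ[k] V) :
    L = T.conv σ hc P R ↔ R = T.conv σ hd Q L := by
  constructor
  · rintro rfl
    rw [← T.conv_assoc hσ hba hc (one_mul c) hd, hQP, T.conv_counit_left he]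
  · rintro rfl
    rw [← T.conv_assoc hσ hab hd (one_mul d) hc, hPQ, T.conv_counit_left he]

end Module

theorem conv_rmulAct_crossing {p : G} {M : Type*} [AddCommGroup M] [Module k M]
    (μ : M ≃ₗ[k] M) (act : H p →ₗ[k] M →ₗ[k] M)
    (h3 : ∀ (a : H p) (m : M), μ (act a m) = act (T.α p a) (μ m)) {r a : G}
    (ρ : M →ₗ[k] M ⊗[k] H r)
    (h6 : ∀ m, ρ (μ m) = TensorProduct.map μ.toLinearMap (T.α r).toLinearMap (ρ m))
    (ha : a * p = p * r) (hπ : p⁻¹ * a * p⁻¹⁻¹ = r) (h : H (p * r)) (m : M) :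
    T.conv (T.rmulAct r) ha (T.dπ p⁻¹ hπ) (act.compr₂ ρ) h m
      = TensorProduct.map μ.toLinearMap (TensorProduct.lift (T.mul r))
        (TensorProduct.assoc k M (H r) (H r)
          (TensorProduct.comm k (H r) (M ⊗[k] H r)
            (TensorProduct.map (T.dπ p⁻¹ hπ) (ρ.comp (TensorProduct.lift act))
              (TensorProduct.assoc k (H a) (H p) M
                (T.comul a p (cst k ha.symm h) ⊗ₜ μ.symm m))))) := by
  simp only [conv_apply, dcomul, LinearMap.comp_apply]
  generalize T.comul a p (cst k ha.symm h) = t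
  induction t with
  | zero => simp
  | add s t hs ht =>
    simp only [map_add, LinearMap.add_apply, TensorProduct.add_tmul, hs, ht]
  | tmul u v =>
    have hv : act (T.α p v) m = μ (act v (μ.symm m)) := by simp [h3]
    simp only [TensorProduct.map_tmul, LinearEquiv.coe_coe, TensorProduct.lift.tmul,
      LinearMap.compl₁₂_apply, rmulAct_apply, LinearMap.compr₂_apply, hv, h6,
      TensorProduct.assoc_tmul, TensorProduct.comm_tmul, LinearMap.comp_apply, dπ_α]
    generalize ρ _ = s
    induction s with
    | zero => simp
    | add s t hs ht => simp only [map_add, TensorProduct.add_tmul, hs, ht]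
    | tmul y z => simp [dmul_apply, ← T.ax.α_mul]

theorem diagAct_tmul {p r : G} {M : Type*} [AddCommGroup M] [Module k M]
    (act : H p →ₗ[k] M →ₗ[k] M) (ρ : M →ₗ[k] M ⊗[k] H r) (h : H (p * r)) (m : M) :
    T.diagAct p r act ρ h m
      = TensorProduct.map (TensorProduct.lift act) (TensorProduct.lift (T.mul r))
        (TensorProduct.tensorTensorTensorComm k (H p) (H r) M (H r)
          (T.comul p r h ⊗ₜ ρ m)) := rfl

theorem conv_rmulAct_antipode_symm {p r a : G} {M : Type*} [AddCommGroup M] [Module k M]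
    (act : H p →ₗ[k] M →ₗ[k] M) (ρ : M →ₗ[k] M ⊗[k] H r)
    (hb : a * (p * r) = p) (hc : a * p = p * r⁻¹) (hd : p * r⁻¹ * r = p)
    (hπ : p⁻¹ * a * p⁻¹⁻¹ = r⁻¹) (h : H p) (m : M) :
    T.conv (T.rmulAct r) hb ((T.antipode r).symm.toLinearMap.comp (T.dπ p⁻¹ hπ))
        (T.diagAct p r act ρ) h m
      = TensorProduct.map LinearMap.id (TensorProduct.lift (T.mul r).flip)
        (TensorProduct.assoc k M (H r) (H r)
          (TensorProduct.map (TensorProduct.comm k (H r) M).toLinearMap LinearMap.id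
            (TensorProduct.map
              ((TensorProduct.map LinearMap.id (TensorProduct.lift act)).comp
                (TensorProduct.assoc k (H r) (H p) M).toLinearMap)
              ((T.α r).symm.toLinearMap.comp (TensorProduct.lift (T.mul r)))
              (TensorProduct.tensorTensorTensorComm k (H r ⊗[k] H p) (H r) M (H r)
                (TensorProduct.map
                  (TensorProduct.map
                    ((T.antipode r).symm.toLinearMap.comp
                      ((T.dπ p⁻¹ hπ).comp (T.α a).toLinearMap))
                    (T.α p).toLinearMap)
                  LinearMap.id
                  (TensorProduct.map ((T.comul a p).comp (cst k hc.symm)) LinearMap.id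
                    (T.comul (p * r⁻¹) r (cst k hd.symm h))) ⊗ₜ ρ m))))) := by
  let f : H a →ₗ[k] H r := (T.antipode r).symm.toLinearMap.comp (T.dπ p⁻¹ hπ)
  have hf : ∀ x, f (T.α a x) = T.α r (f x) := fun x => by
    simp [f, dπ_α, antipode_symm_α]
  let τ : H a ⊗[k] (H p ⊗[k] H r) →ₗ[k] M ⊗[k] H r :=
    TensorProduct.lift (LinearMap.mk₂ k (fun x t =>
      T.rmulAct r (f (T.α a (T.α a x)))
        (TensorProduct.curry
          ((TensorProduct.map (TensorProduct.lift act) (TensorProduct.lift (T.mul r))).comp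
            ((TensorProduct.tensorTensorTensorComm k (H p) (H r) M (H r)).toLinearMap.comp
              (TensorProduct.map
                (TensorProduct.map (T.α p).toLinearMap (T.α r).toLinearMap) ρ))) t) m)
      (fun x y t => by simp only [map_add, LinearMap.add_apply])
      (fun c x t => by simp only [map_smul, LinearMap.smul_apply])
      (fun x t t' => by simp only [map_add, LinearMap.add_apply])
      (fun c x t => by simp only [map_smul, LinearMap.smul_apply]))
  have key := congrArg τ (T.comul_coassoc hc rfl hd hb h)
  refine Eq.trans ?_ (key.trans ?_)
  · simp only [conv_apply, dcomul, LinearMap.comp_apply]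
    generalize T.comul a (p * r) (cst k hb.symm h) = t
    induction t with
    | zero => simp
    | add s t hs ht => simp only [map_add, LinearMap.add_apply, hs, ht]
    | tmul u v =>
      have hcst : cst k (rfl : p * r = p * r) v = v := rfl
      simp only [TensorProduct.map_tmul, LinearEquiv.coe_coe, TensorProduct.lift.tmul,
        LinearMap.compl₁₂_apply, rmulAct_apply, diagAct_tmul, comul_α, LinearMap.comp_apply, τ,
        LinearMap.mk₂_apply, TensorProduct.curry_apply, LinearEquiv.apply_symm_apply, f, hcst]
  · generalize T.comul (p * r⁻¹) r (cst k hd.symm h) = t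
    induction t with
    | zero => simp
    | add s t hs ht => simp only [map_add, TensorProduct.add_tmul, hs, ht]
    | tmul u v =>
      simp only [TensorProduct.map_tmul, LinearMap.comp_apply, LinearMap.id_apply]
      generalize T.comul a p (cst k hc.symm u) = s
      induction s with
      | zero => simp
      | add s t hs ht => simp only [map_add, TensorProduct.add_tmul, hs, ht]
      | tmul y z =>
        have hfy : (T.antipode r).symm (T.dπ p⁻¹ hπ (T.α a y)) = f (T.α a y) := rfl
        simp only [TensorProduct.map_tmul, LinearMap.comp_apply, LinearEquiv.coe_coe, hfy,
          TensorProduct.assoc_tmul, τ, TensorProduct.lift.tmul, LinearMap.mk₂_apply,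
          rmulAct_apply, TensorProduct.curry_apply, LinearEquiv.apply_symm_apply]
        generalize ρ m = w
        induction w with
        | zero => simp
        | add s t hs ht => simp only [map_add, TensorProduct.tmul_add, hs, ht]
        | tmul m' q => simp [dmul_apply, hf, α_symm_mul]

end HomTC

/-- For a left `H p`-Hom-module and right `H`-Hom-comodule, the
Yetter-Drinfeld compatibility condition is equivalent to condition (4.7). -/
theorem statement4 (T : HomTC k G H) (p : G) (M : Type*) [AddCommGroup M] [Module k M]
    (μ : M ≃ₗ[k] M) (act : H p →ₗ[k] M →ₗ[k] M) (ρ : ∀ r : G, M →ₗ[k] M ⊗[k] H r)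
    (h1 : ∀ (a b : H p) (m : M), act (T.α p a) (act b m) = act (T.mul p a b) (μ m))
    (h2 : ∀ m : M, act (T.one p) m = μ m)
    (h3 : ∀ (a : H p) (m : M), μ (act a m) = act (T.α p a) (μ m))
    (h4 : ∀ a b : G,
      (TensorProduct.map μ.symm.toLinearMap (T.comul a b)).comp (ρ (a * b))
      = (TensorProduct.assoc k M (H a) (H b)).toLinearMap.comp
          ((TensorProduct.map (ρ a) (T.α b).symm.toLinearMap).comp (ρ b)))
    (h5 : ∀ m : M,
      (TensorProduct.rid k M) ((TensorProduct.map LinearMap.id T.counit) (ρ 1 m)) = μ.symm m)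
    (h6 : ∀ r : G,
      (ρ r).comp μ.toLinearMap
        = (TensorProduct.map μ.toLinearMap (T.α r).toLinearMap).comp (ρ r)) :
    YDcompat k T p μ act ρ ↔
      ∀ r : G, (ρ r).comp (TensorProduct.lift act) = rhs47 k T p μ act ρ r := by
  have h6' : ∀ r m, ρ r (μ m)
      = TensorProduct.map μ.toLinearMap (T.α r).toLinearMap (ρ r m) :=
    fun r => LinearMap.congr_fun (h6 r)
  refine forall_congr' fun r => ?_
  have hab : (p * r * p⁻¹) * (p * r⁻¹ * p⁻¹) = 1 := by group
  have hba : (p * r⁻¹ * p⁻¹) * (p * r * p⁻¹) = 1 := by group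
  have hc : (p * r * p⁻¹) * p = p * r := by group
  have hd : (p * r⁻¹ * p⁻¹) * (p * r) = p := by group
  have hP : p⁻¹ * (p * r * p⁻¹) * p⁻¹⁻¹ = r := by group
  have hQ : p⁻¹ * (p * r⁻¹ * p⁻¹) * p⁻¹⁻¹ = r⁻¹ := by group
  have key := T.eq_conv_iff (T.rmulAct_rmulAct (M := M)) T.rmulAct_one hab hba hc hd
    (T.conv_comp_dπ _ p⁻¹ hP hQ hab (mul_inv_cancel r) _ _ (T.conv_flip_id_antipode_symm r))
    (T.conv_comp_dπ _ p⁻¹ hQ hP hba (inv_mul_cancel r) _ _ (T.conv_flip_antipode_symm_id r))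
    (act.compr₂ (ρ r)) (T.diagAct p r act (ρ r))
  rw [LinearMap.id_comp] at key
  refine Iff.trans ?_ (key.trans ?_)
  · rw [← TensorProduct.curry_injective.eq_iff]
    refine Eq.congr_right ?_
    ext h m
    exact (T.conv_rmulAct_crossing μ act h3 (ρ r) (h6' r) hc hP h m).symm
  · rw [← TensorProduct.curry_injective.eq_iff]
    refine Eq.congr_right ?_
    ext h m
    exact T.conv_rmulAct_antipode_symm act (ρ r) hd (by group) (by group) hQ h m
end
end

section
/- Let (H, α) be a monoidal Hom-Hopf T-coalgebra over G with bijective antipode, (M, μ) a p-Yetter–Drinfeld module and (N, ν) a q-Yetter–Drinfeld module over (H, α). Define ρ^{M⊗N}_r(m ⊗ n) = m_{(0)} ⊗ n_{(0)} ⊗ n_{(1,r)}π_{q^{-1}}(m_{(1,qrq^{-1})}). Then the Hom-coassociativity condition holds: for all r₁, r₂ ∈ G, ((μ ⊗ ν) ⊗ (id ⊗ α_{r₂}^{-1})) applied appropriately, namely ã_{M⊗N,H_{r₁},H_{r₂}} ∘ (ρ^{M⊗N}_{r₁} ⊗ id_{H_{r₂}}) ∘ ρ^{M⊗N}_{r₂}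 = (id_{M⊗N} ⊗ Δ_{r₁,r₂}) ∘ ρ^{M⊗N}_{r₁r₂}, where ã_{X,Y,Z}: (X ⊗ Y) ⊗ Z → X ⊗ (Y ⊗ Z) is the Hom-associator (x ⊗ y) ⊗ z ↦ φ_X(x) ⊗ (y ⊗ φ_Z^{-1}(z)) for the given automorphisms φ_X on X and φ_Z on Z. -/
open TensorProduct

noncomputable section

section CastLemmas

variable {k : Type*} [Field k] {G : Type*} {H : G → Type*}
  [∀ p, AddCommGroup (H p)] [∀ p, Module k (H p)]

theorem cst_cst {a b c : G} (h : a = b) (h' : b = c) (x : H a) :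
    cst k h' (cst k h x) = cst k (h.trans h') x := by
  subst h h'; rfl

theorem map_cst_coact {M : Type*} [AddCommGroup M] [Module k M]
    (ρ : ∀ r : G, M →ₗ[k] M ⊗[k] H r) {a b : G} (h : a = b) (m : M) :
    TensorProduct.map LinearMap.id (cst k h) (ρ a m) = ρ b m := by
  subst h
  exact LinearMap.congr_fun TensorProduct.map_id _

end CastLemmas

section TensorCoaction

variable {k : Type*} [Field k] {G : Type*} [Group G] {H : G → Type*}
  [∀ p, AddCommGroup (H p)] [∀ p, Module k (H p)]

namespace HomTC

/-- The crossing `π_{b⁻¹}` as a map `H (b * r * b⁻¹) → H r`. -/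
def conjBack (T : HomTC k G H) (b r : G) : H (b * r * b⁻¹) →ₗ[k] H r :=
  (cst k (show b⁻¹ * (b * r * b⁻¹) * b⁻¹⁻¹ = r by group)).comp
    (T.π b⁻¹ (b * r * b⁻¹)).toLinearMap

/-- The map `a ⊗ b ↦ b * π_{q⁻¹}(a)` occurring in the tensor product coaction. -/
def mulConj (T : HomTC k G H) (q r : G) : H (q * r * q⁻¹) ⊗[k] H r →ₗ[k] H r :=
  TensorProduct.lift (((T.mul r).flip).comp (T.conjBack q r))

@[simp]
theorem mulConj_tmul (T : HomTC k G H) (q r : G) (a : H (q * r * q⁻¹)) (b : H r) :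
    T.mulConj q r (a ⊗ₜ b) = T.mul r b (T.conjBack q r a) := rfl

theorem cst_α_symm (T : HomTC k G H) {a b : G} (h : a = b) (c : H a) :
    cst k h ((T.α a).symm c) = (T.α b).symm (cst k h c) := by
  subst h; rfl

theorem π_α_symm (T : HomTC k G H) (q p : G) (c : H p) :
    T.π q p ((T.α p).symm c) = (T.α (q * p * q⁻¹)).symm (T.π q p c) := by
  rw [LinearEquiv.eq_symm_apply, ← T.cax.π_α, LinearEquiv.apply_symm_apply]

theorem conjBack_α_symm (T : HomTC k G H) (b r : G) (c : H (b * r * b⁻¹)) :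
    T.conjBack b r ((T.α (b * r * b⁻¹)).symm c) = (T.α r).symm (T.conjBack b r c) := by
  simp [conjBack, π_α_symm, cst_α_symm]

theorem mul_α_symm (T : HomTC k G H) (p : G) (a b : H p) :
    (T.α p).symm (T.mul p a b) = T.mul p ((T.α p).symm a) ((T.α p).symm b) := by
  simp [LinearEquiv.symm_apply_eq, T.ax.α_mul]

theorem map_cst_comul (T : HomTC k G H) {a a' b b' : G} (ha : a = a') (hb : b = b')
    (c : H (a * b)) :
    TensorProduct.map (cst k ha) (cst k hb) (T.comul a b c) =
      T.comul a' b' (cst k (congrArg₂ (· * ·) ha hb) c) := by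
  subst ha hb
  change TensorProduct.map LinearMap.id LinearMap.id _ = _
  rw [TensorProduct.map_id]; rfl

theorem π_cst (T : HomTC k G H) (q : G) {a b : G} (h : a = b) (c : H a) :
    T.π q b (cst k h c) = cst k (congrArg (fun x => q * x * q⁻¹) h) (T.π q a c) := by
  subst h; rfl

theorem map_conjBack_comul (T : HomTC k G H) (q r s : G)
    (c : H ((q * r * q⁻¹) * (q * s * q⁻¹))) :
    TensorProduct.map (T.conjBack q r) (T.conjBack q s) (T.comul _ _ c) =
      T.comul r s (T.conjBack q (r * s)
        (cst k (show (q * r * q⁻¹) * (q * s * q⁻¹) = q * (r * s) * q⁻¹ by group) c)) := by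
  rw [conjBack, conjBack, TensorProduct.map_comp, LinearMap.comp_apply, T.cax.π_comul,
    map_cst_comul, conjBack, LinearMap.comp_apply, LinearEquiv.coe_coe,
    π_cst, cst_cst, cst_cst]

/-- The componentwise products `a ⊗ a' ⊗ (b ⊗ b') ↦ b * π_{q⁻¹}(a) ⊗ b' * π_{q⁻¹}(a')`. -/
def mulConj₂ (T : HomTC k G H) (q r s : G) :
    (H (q * r * q⁻¹) ⊗[k] H (q * s * q⁻¹)) ⊗[k] (H r ⊗[k] H s) →ₗ[k] H r ⊗[k] H s :=
  (TensorProduct.map (T.mulConj q r) (T.mulConj q s)).comp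
    (TensorProduct.tensorTensorTensorComm k _ _ _ _).toLinearMap

theorem comul_mulConj (T : HomTC k G H) (q r s : G)
    (c : H ((q * r * q⁻¹) * (q * s * q⁻¹))) (d : H (r * s)) :
    T.comul r s (T.mulConj q (r * s)
        (cst k (show (q * r * q⁻¹) * (q * s * q⁻¹) = q * (r * s) * q⁻¹ by group) c ⊗ₜ d)) =
      T.mulConj₂ q r s (T.comul _ _ c ⊗ₜ T.comul r s d) := by
  rw [mulConj_tmul, T.ax.comul_mul, ← map_conjBack_comul]
  generalize T.comul _ _ c = x
  generalize T.comul r s d = y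
  induction x with
  | zero => simp
  | add x₁ x₂ h₁ h₂ => simp only [map_add, TensorProduct.add_tmul, h₁, h₂]
  | tmul a a' =>
    induction y with
    | zero => simp
    | add y₁ y₂ h₁ h₂ =>
      simp only [map_add, LinearMap.add_apply, TensorProduct.tmul_add, h₁, h₂]
    | tmul b b' => simp [mulConj₂]

variable {M N : Type*} [AddCommGroup M] [Module k M] [AddCommGroup N] [Module k N]

/-- Applies `μ ⊗ ν` to the module factors and `mulConj₂` to the coalgebra factors. -/
def combineCoact (T : HomTC k G H) (q r s : G) (μ : M ≃ₗ[k] M) (ν : N ≃ₗ[k] N) :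
    (M ⊗[k] (H (q * r * q⁻¹) ⊗[k] H (q * s * q⁻¹))) ⊗[k] (N ⊗[k] (H r ⊗[k] H s)) →ₗ[k]
      (M ⊗[k] N) ⊗[k] (H r ⊗[k] H s) :=
  (TensorProduct.map (TensorProduct.congr μ ν).toLinearMap (T.mulConj₂ q r s)).comp
    (TensorProduct.tensorTensorTensorComm k _ _ _ _).toLinearMap

/-- Pairs the components of `M ⊗ H (q * r * q⁻¹)` and `N ⊗ H r` using `mulConj`. -/
def pairCoact (T : HomTC k G H) (q r : G) :
    (M ⊗[k] H (q * r * q⁻¹)) ⊗[k] (N ⊗[k] H r) →ₗ[k] (M ⊗[k] N) ⊗[k] H r :=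
  (TensorProduct.map LinearMap.id (T.mulConj q r)).comp
    (TensorProduct.tensorTensorTensorComm k _ _ _ _).toLinearMap

theorem tCoact_tmul (T : HomTC k G H) (q r : G)
    (ρM : ∀ r : G, M →ₗ[k] M ⊗[k] H r) (ρN : ∀ r : G, N →ₗ[k] N ⊗[k] H r) (m : M) (n : N) :
    tCoact k T q ρM ρN r (m ⊗ₜ n) = T.pairCoact q r (ρM (q * r * q⁻¹) m ⊗ₜ ρN r n) := rfl

@[simp]
theorem pairCoact_tmul (T : HomTC k G H) (q r : G) (m : M) (n : N) (a : H (q * r * q⁻¹))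
    (b : H r) :
    T.pairCoact q r ((m ⊗ₜ[k] a) ⊗ₜ[k] (n ⊗ₜ[k] b)) =
      (m ⊗ₜ n) ⊗ₜ T.mulConj q r (a ⊗ₜ b) := rfl

theorem homAssoc_pairCoact (T : HomTC k G H) (q r s : G) (μ : M ≃ₗ[k] M) (ν : N ≃ₗ[k] N)
    (x : M ⊗[k] H (q * r * q⁻¹)) (y : N ⊗[k] H r) (a : H (q * s * q⁻¹)) (b : H s) :
    homAssoc k (TensorProduct.congr μ ν) (T.α s)
        (T.pairCoact q r (x ⊗ₜ y) ⊗ₜ T.mulConj q s (a ⊗ₜ b)) =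
      T.combineCoact q r s μ ν
        (TensorProduct.assoc k _ _ _ (x ⊗ₜ (T.α (q * s * q⁻¹)).symm a) ⊗ₜ
          TensorProduct.assoc k _ _ _ (y ⊗ₜ (T.α s).symm b)) := by
  induction x with
  | zero => simp
  | add x₁ x₂ h₁ h₂ => simp only [map_add, TensorProduct.add_tmul, h₁, h₂]
  | tmul m a' =>
    induction y with
    | zero => simp
    | add y₁ y₂ h₁ h₂ =>
      simp only [map_add, TensorProduct.add_tmul, TensorProduct.tmul_add, h₁, h₂]
    | tmul n b' =>
      simp [homAssoc, combineCoact, mulConj₂, mul_α_symm, conjBack_α_symm]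

theorem homAssoc_map_tCoact_pairCoact (T : HomTC k G H) (q r s : G) (μ : M ≃ₗ[k] M)
    (ν : N ≃ₗ[k] N) (ρM : ∀ r : G, M →ₗ[k] M ⊗[k] H r) (ρN : ∀ r : G, N →ₗ[k] N ⊗[k] H r)
    (x : M ⊗[k] H (q * s * q⁻¹)) (y : N ⊗[k] H s) :
    homAssoc k (TensorProduct.congr μ ν) (T.α s)
        (TensorProduct.map (tCoact k T q ρM ρN r) LinearMap.id (T.pairCoact q s (x ⊗ₜ y))) =
      T.combineCoact q r s μ ν
        (TensorProduct.assoc k _ _ _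
            (TensorProduct.map (ρM (q * r * q⁻¹)) (T.α (q * s * q⁻¹)).symm.toLinearMap x) ⊗ₜ
          TensorProduct.assoc k _ _ _
            (TensorProduct.map (ρN r) (T.α s).symm.toLinearMap y)) := by
  induction x with
  | zero => simp
  | add x₁ x₂ h₁ h₂ => simp only [map_add, TensorProduct.add_tmul, h₁, h₂]
  | tmul m a =>
    induction y with
    | zero => simp
    | add y₁ y₂ h₁ h₂ => simp only [map_add, TensorProduct.tmul_add, h₁, h₂]
    | tmul n b =>
      rw [pairCoact_tmul, TensorProduct.map_tmul, tCoact_tmul, LinearMap.id_apply,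
        homAssoc_pairCoact]
      rfl

theorem map_comul_pairCoact (T : HomTC k G H) (q r s : G) (μ : M ≃ₗ[k] M) (ν : N ≃ₗ[k] N)
    (x : M ⊗[k] H ((q * r * q⁻¹) * (q * s * q⁻¹))) (y : N ⊗[k] H (r * s)) :
    TensorProduct.map LinearMap.id (T.comul r s)
        (T.pairCoact q (r * s)
          (TensorProduct.map LinearMap.id
            (cst k (show (q * r * q⁻¹) * (q * s * q⁻¹) = q * (r * s) * q⁻¹ by group)) x ⊗ₜ y)) =
      T.combineCoact q r s μ ν
        (TensorProduct.map μ.symm.toLinearMap (T.comul _ _) x ⊗ₜ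
          TensorProduct.map ν.symm.toLinearMap (T.comul r s) y) := by
  induction x with
  | zero => simp
  | add x₁ x₂ h₁ h₂ => simp only [map_add, TensorProduct.add_tmul, h₁, h₂]
  | tmul m a =>
    induction y with
    | zero => simp
    | add y₁ y₂ h₁ h₂ => simp only [map_add, TensorProduct.tmul_add, h₁, h₂]
    | tmul n b =>
      rw [TensorProduct.map_tmul, LinearMap.id_apply, pairCoact_tmul, TensorProduct.map_tmul,
        comul_mulConj]
      simp [combineCoact]

end HomTC

end TensorCoaction

/-- Hom-coassociativity of the coaction on the tensor product of
Yetter-Drinfeld modules. -/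
theorem statement7 {k : Type*} [Field k] {G : Type*} [Group G] {H : G → Type*}
    [∀ p, AddCommGroup (H p)] [∀ p, Module k (H p)]
    (T : HomTC k G H) (p q : G)
    (M : Type*) [AddCommGroup M] [Module k M] (N : Type*) [AddCommGroup N] [Module k N]
    (μ : M ≃ₗ[k] M) (actM : H p →ₗ[k] M →ₗ[k] M) (ρM : ∀ r : G, M →ₗ[k] M ⊗[k] H r)
    (ν : N ≃ₗ[k] N) (actN : H q →ₗ[k] N →ₗ[k] N) (ρN : ∀ r : G, N →ₗ[k] N ⊗[k] H r)
    (hM : IsYD k T p μ actM ρM) (hN : IsYD k T q ν actN ρN) :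
    ∀ r₁ r₂ : G,
      (homAssoc k (TensorProduct.congr μ ν) (T.α r₂)).toLinearMap.comp
        ((TensorProduct.map (tCoact k T q ρM ρN r₁) LinearMap.id).comp
          (tCoact k T q ρM ρN r₂))
      = (TensorProduct.map LinearMap.id (T.comul r₁ r₂)).comp
          (tCoact k T q ρM ρN (r₁ * r₂)) := by
  intro r₁ r₂
  refine TensorProduct.ext' fun m n => ?_
  simp only [LinearMap.comp_apply, LinearEquiv.coe_coe, HomTC.tCoact_tmul]
  have hm := LinearMap.congr_fun (hM.ρ_coassoc (q * r₁ * q⁻¹) (q * r₂ * q⁻¹)) m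
  have hn := LinearMap.congr_fun (hN.ρ_coassoc r₁ r₂) n
  simp only [LinearMap.comp_apply, LinearEquiv.coe_coe] at hm hn
  rw [HomTC.homAssoc_map_tCoact_pairCoact, ← hm, ← hn, ← HomTC.map_comul_pairCoact,
    map_cst_coact]
end
end
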